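/- First-order regularity propagation with explicit rate for the von Neumann equation in Weyl variables: let V : ℝ → ℝ be of class C² with ‖V''‖_∞ < ∞ and V'(0) = 0, let ħ ∈ (0,2], let R be a strong solution of the von Neumann equation in Weyl variables with parameter ħ, and set L := max(1, ‖V''‖_∞). Then for every t ≥ 0, 𝒩₁(t) ≤ 𝒩₁(0) e^{2L t}. -/

import Mathlib

open MeasureTheory

noncomputable section

/-- Mixed partial derivative `∂_x^b ∂_y^β` of a function `f(x,y)`. -/
def pd2 (b β : ℕ) (f : ℝ → ℝ → ℂ) (x y : ℝ) : ℂ :=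
  iteratedDeriv b (fun x' => iteratedDeriv β (fun y' => f x' y') y) x

/-- Weighted derivative `x^a ∂_x^b y^α ∂_y^β` of `f(x,y)`. -/
def wD (a b α β : ℕ) (f : ℝ → ℝ → ℂ) (x y : ℝ) : ℂ :=
  (x : ℂ) ^ a * (y : ℂ) ^ α * pd2 b β f x y

/-- Uncurried version of a two-variable function. -/
def unc (f : ℝ → ℝ → ℂ) : ℝ × ℝ → ℂ := fun p => f p.1 p.2

/-- L² norm over ℝ². -/
def L2 (f : ℝ → ℝ → ℂ) : ℝ := (eLpNorm (unc f) 2 (volume : Measure (ℝ × ℝ))).toReal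

/-- L² norm over ℝ. -/
def L2one (f : ℝ → ℂ) : ℝ := (eLpNorm f 2 (volume : Measure ℝ)).toReal

/-- Schwartz-class predicate for smooth functions of two real variables. -/
def IsSchwartz2 (f : ℝ → ℝ → ℂ) : Prop :=
  ContDiff ℝ (⊤ : ℕ∞) (unc f) ∧
    ∀ k n : ℕ, ∃ C : ℝ, ∀ p : ℝ × ℝ, ‖p‖ ^ k * ‖iteratedFDeriv ℝ n (unc f) p‖ ≤ C

/-- Schwartz-class predicate for smooth functions of one real variable. -/
def IsSchwartz1 (f : ℝ → ℂ) : Prop :=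
  ContDiff ℝ (⊤ : ℕ∞) f ∧ ∀ k n : ℕ, ∃ C : ℝ, ∀ x : ℝ, |x| ^ k * ‖iteratedDeriv n f x‖ ≤ C

/-- Time derivative of a time-dependent two-variable function. -/
def dtR (R : ℝ → ℝ → ℝ → ℂ) (t x y : ℝ) : ℂ := deriv (fun s => R s x y) t

/-- For all `a b α β`, the map `t ↦ x^a ∂_x^b y^α ∂_y^β R(t,·,·)` is continuously
differentiable from `[0,∞)` into `L²(ℝ²)` with derivative `x^a ∂_x^b y^α ∂_y^β ∂_t R(t,·,·)`. -/
def C1intoL2 (R : ℝ → ℝ → ℝ → ℂ) : Prop :=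
  ∀ a b α β : ℕ, ∃ Ψ Ψ' : ℝ → Lp ℂ 2 (volume : Measure (ℝ × ℝ)),
    (∀ t : ℝ, 0 ≤ t → (Ψ t : ℝ × ℝ → ℂ) =ᵐ[volume] unc (wD a b α β (R t))) ∧
    (∀ t : ℝ, 0 ≤ t → (Ψ' t : ℝ × ℝ → ℂ) =ᵐ[volume] unc (wD a b α β (dtR R t))) ∧
    (∀ t : ℝ, 0 ≤ t → HasDerivWithinAt Ψ (Ψ' t) (Set.Ici 0) t) ∧
    ContinuousOn Ψ' (Set.Ici 0)

/-- Regularity part of the notion of strong solution on `[0,∞) × ℝ²`. -/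
def IsRegularSol (R : ℝ → ℝ → ℝ → ℂ) : Prop :=
  ContDiffOn ℝ (⊤ : ℕ∞) (fun p : ℝ × ℝ × ℝ => R p.1 p.2.1 p.2.2) {p : ℝ × ℝ × ℝ | 0 ≤ p.1} ∧
  (∀ t : ℝ, 0 ≤ t → IsSchwartz2 (R t)) ∧ C1intoL2 R

/-- Strong solution of the von Neumann equation in Weyl variables. -/
def IsVNSol (hbar : ℝ) (V : ℝ → ℝ) (R : ℝ → ℝ → ℝ → ℂ) : Prop :=
  IsRegularSol R ∧
  ∀ t : ℝ, 0 ≤ t → ∀ x y : ℝ,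
    dtR R t x y = Complex.I * pd2 1 1 (R t) x y -
      Complex.I * (((V (x + hbar * y / 2) - V (x - hbar * y / 2)) / hbar : ℝ) : ℂ) * R t x y

/-- Strong solution of the semiclassical equation. -/
def IsSCSol (V : ℝ → ℝ) (R : ℝ → ℝ → ℝ → ℂ) : Prop :=
  IsRegularSol R ∧
  ∀ t : ℝ, 0 ≤ t → ∀ x y : ℝ,
    dtR R t x y = Complex.I * pd2 1 1 (R t) x y -
      Complex.I * ((deriv V x * y : ℝ) : ℂ) * R t x y

/-- The weighted Sobolev functional `𝒩_m` applied to a function of `(x,y)`. -/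
def NN (m : ℕ) (f : ℝ → ℝ → ℂ) : ℝ :=
  ∑ q ∈ Finset.filter
      (fun q : ℕ × ℕ × ℕ × ℕ => q.1 + q.2.1 + q.2.2.1 + q.2.2.2 ≤ m)
      (Finset.range (m+1) ×ˢ Finset.range (m+1) ×ˢ Finset.range (m+1) ×ˢ Finset.range (m+1)),
    L2 (wD q.1 q.2.1 q.2.2.1 q.2.2.2 f)

/-- Supremum norm of a real-valued function. -/
def supN (f : ℝ → ℝ) : ℝ := ⨆ x : ℝ, |f x|

/-- The constant `C_m[V]`. -/
def CmV (m : ℕ) (V : ℝ → ℝ) : ℝ :=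
  ((m : ℝ)^2 + 2*m + m * supN (iteratedDeriv 2 V) + m * |deriv V 0|) +
    2^m * (1+m) * m * (⨆ n ∈ Finset.Icc 2 (m+1), supN (iteratedDeriv n V))

/-- Physicists' Hermite polynomial. -/
def Hpoly (k : ℕ) (y : ℝ) : ℝ :=
  (-1)^k * Real.exp (y^2) * iteratedDeriv k (fun z => Real.exp (-z^2)) y

/-- Hermite function `Φ_k`. -/
def Φh (k : ℕ) (y : ℝ) : ℝ :=
  ((2:ℝ)^k * (Nat.factorial k : ℝ) * Real.sqrt Real.pi) ^ (-(1:ℝ)/2) *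
    Real.exp (-y^2/2) * Hpoly k y

/-- The operator `𝒟 u = ∂_x u + V'(x) u`. -/
def Dop (V : ℝ → ℝ) (u : ℝ → ℂ) (x : ℝ) : ℂ := deriv u x + ((deriv V x : ℝ) : ℂ) * u x

/-- The operator `𝒟* u = −∂_x u + V'(x) u`. -/
def Dstar (V : ℝ → ℝ) (u : ℝ → ℂ) (x : ℝ) : ℂ := -deriv u x + ((deriv V x : ℝ) : ℂ) * u x

/-- The quantum correction `ℰ^ħ(x,y)`. -/
def Eh (hbar : ℝ) (V : ℝ → ℝ) (x y : ℝ) : ℝ :=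
  (V (x + hbar * y / 2) - V (x - hbar * y / 2)) / hbar - deriv V x * y

/-- Matrix elements `ℰ^ħ_{k,l}(x)` of the quantum correction. -/
def Ekl (hbar : ℝ) (V : ℝ → ℝ) (k l : ℕ) (x : ℝ) : ℝ :=
  ∫ y : ℝ, Eh hbar V x y * Φh k y * Φh l y

/-- `t ↦ u(t,·)` is continuously differentiable from `[0,∞)` into `L²(ℝ)` with
derivative `∂_t u`. -/
def C1intoL2one (u : ℝ → ℝ → ℂ) : Prop :=
  ∃ Ψ Ψ' : ℝ → Lp ℂ 2 (volume : Measure ℝ),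
    (∀ t : ℝ, 0 ≤ t → (Ψ t : ℝ → ℂ) =ᵐ[volume] u t) ∧
    (∀ t : ℝ, 0 ≤ t → (Ψ' t : ℝ → ℂ) =ᵐ[volume] fun x => deriv (fun s => u s x) t) ∧
    (∀ t : ℝ, 0 ≤ t → HasDerivWithinAt Ψ (Ψ' t) (Set.Ici 0) t) ∧
    ContinuousOn Ψ' (Set.Ici 0)

/-- Regularity part of the notion of strong solution of a Hermite–Galerkin system of size `N`;
the convention `R_k = 0` for `k > N` is included. -/
def IsGalerkinReg (N : ℕ) (R : ℕ → ℝ → ℝ → ℂ) : Prop :=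
  (∀ k, k ≤ N → ContDiffOn ℝ (⊤ : ℕ∞) (fun p : ℝ × ℝ => R k p.1 p.2) {p : ℝ × ℝ | 0 ≤ p.1}) ∧
  (∀ k, k ≤ N → ∀ t : ℝ, 0 ≤ t → IsSchwartz1 (R k t)) ∧
  (∀ k, k ≤ N → C1intoL2one (R k)) ∧
  (∀ k, N < k → ∀ t x : ℝ, R k t x = 0)

/-- Strong solution of the semiclassical Hermite–Galerkin system of size `N`.
(For `k = 0` the coefficient `√(k/2)` vanishes, so the term `R_{k-1}` is harmless.) -/
def IsSCGalerkinSol (V : ℝ → ℝ) (N : ℕ) (R : ℕ → ℝ → ℝ → ℂ) : Prop :=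
  IsGalerkinReg N R ∧
  ∀ k, k ≤ N → ∀ t : ℝ, 0 ≤ t → ∀ x : ℝ,
    deriv (fun s => R k s x) t +
      Complex.I * ((Real.sqrt ((k : ℝ)/2) : ℂ) * Dop V (R (k-1) t) x +
        (Real.sqrt (((k : ℝ)+1)/2) : ℂ) * Dstar V (R (k+1) t) x) = 0

/-- Strong solution of the von Neumann Hermite–Galerkin system of size `N`. -/
def IsVNGalerkinSol (hbar : ℝ) (V : ℝ → ℝ) (N : ℕ) (R : ℕ → ℝ → ℝ → ℂ) : Prop :=
  IsGalerkinReg N R ∧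
  ∀ k, k ≤ N → ∀ t : ℝ, 0 ≤ t → ∀ x : ℝ,
    deriv (fun s => R k s x) t +
      Complex.I * ((Real.sqrt ((k : ℝ)/2) : ℂ) * Dop V (R (k-1) t) x +
        (Real.sqrt (((k : ℝ)+1)/2) : ℂ) * Dstar V (R (k+1) t) x) =
      -Complex.I * ∑ l ∈ Finset.range (N+1), ((Ekl hbar V k l x : ℝ) : ℂ) * R l t x

/-- Smooth potential with all derivatives of order `≥ 2` bounded. -/
def SmoothBounded (V : ℝ → ℝ) : Prop :=
  ContDiff ℝ (⊤ : ℕ∞) V ∧ ∀ n : ℕ, 2 ≤ n → ∃ C : ℝ, ∀ x : ℝ, |iteratedDeriv n V x| ≤ C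

/-- The harmonic-oscillator operator `A G = y² G − G''`. -/
def Aop (g : ℝ → ℂ) : ℝ → ℂ := fun y => (y : ℂ)^2 * g y - iteratedDeriv 2 g y

open scoped SchwartzMap LineDeriv

section Energy

variable {H : Type*} [NormedAddCommGroup H] [InnerProductSpace ℝ H]

/-- Grönwall inequality for a finite sum of norms, each of which may vanish. -/
theorem sum_norm_le_mul_exp_of_inner_le {ι : Type*} [Fintype ι] {Ψ Ψ' : ι → ℝ → H}
    {G : ι → ℝ → ℝ} {K : ℝ} (hK : 0 ≤ K)
    (hΨ : ∀ i t, 0 ≤ t → HasDerivWithinAt (Ψ i) (Ψ' i t) (Set.Ici 0) t)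
    (hG : ∀ i t, 0 ≤ t → 0 ≤ G i t)
    (hinner : ∀ i t, 0 ≤ t → inner ℝ (Ψ i t) (Ψ' i t) ≤ G i t * ‖Ψ i t‖)
    (hsum : ∀ t, 0 ≤ t → ∑ i, G i t ≤ K * ∑ i, ‖Ψ i t‖) {t : ℝ} (ht : 0 ≤ t) :
    ∑ i, ‖Ψ i t‖ ≤ (∑ i, ‖Ψ i 0‖) * Real.exp (K * t) := by
  let φ : ℝ → ι → ℝ → ℝ := fun ε i s => √(‖Ψ i s‖ ^ 2 + ε ^ 2)
  have hφ_ge (ε : ℝ) (i : ι) (s : ℝ) : ‖Ψ i s‖ ≤ φ ε i s :=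
    Real.le_sqrt_of_sq_le (by nlinarith [sq_nonneg ε])
  have hφ_deriv (ε : ℝ) (hε : 0 < ε) (i : ι) (s : ℝ) (hs : 0 ≤ s) :
      HasDerivWithinAt (φ ε i) (inner ℝ (Ψ i s) (Ψ' i s) / φ ε i s) (Set.Ici 0) s := by
    have h := (((hΨ i s hs).norm_sq).add_const (ε ^ 2)).sqrt (by positivity)
    convert h using 1
    rw [mul_div_mul_left _ _ two_ne_zero]
  have hle (ε : ℝ) (hε : 0 < ε) :
      ∑ i, ‖Ψ i t‖ ≤ (∑ i, φ ε i 0) * Real.exp (K * t) := by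
    let F : ℝ → ℝ := fun s => (∑ i, φ ε i s) * Real.exp (-K * s)
    have hF (s : ℝ) (hs : 0 ≤ s) : HasDerivWithinAt F
        ((∑ i, inner ℝ (Ψ i s) (Ψ' i s) / φ ε i s) * Real.exp (-K * s) +
          (∑ i, φ ε i s) * (Real.exp (-K * s) * (-K * 1))) (Set.Ici 0) s := by
      refine HasDerivWithinAt.mul ?_ (((hasDerivAt_id s).const_mul (-K)).exp.hasDerivWithinAt)
      exact HasDerivWithinAt.fun_sum fun i _ => hφ_deriv ε hε i s hs
    have hanti : AntitoneOn F (Set.Ici 0) := by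
      refine antitoneOn_of_hasDerivWithinAt_nonpos (convex_Ici 0)
        (fun s hs => (hF s hs).continuousWithinAt)
        (fun s hs => (hF s (interior_subset hs)).mono interior_subset) fun s hs => ?_
      have hs : 0 ≤ s := interior_subset hs
      have h1 : ∑ i, inner ℝ (Ψ i s) (Ψ' i s) / φ ε i s ≤ ∑ i, G i s := by
        refine Finset.sum_le_sum fun i _ => ?_
        have hpos : 0 < φ ε i s := Real.sqrt_pos.2 (by positivity)
        rw [div_le_iff₀ hpos]
        exact (hinner i s hs).trans (mul_le_mul_of_nonneg_left (hφ_ge ε i s) (hG i s hs))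
      have h2 : K * ∑ i, ‖Ψ i s‖ ≤ K * ∑ i, φ ε i s :=
        mul_le_mul_of_nonneg_left (Finset.sum_le_sum fun i _ => hφ_ge ε i s) hK
      have h3 := (h1.trans (hsum s hs)).trans h2
      nlinarith [mul_le_mul_of_nonneg_right h3 (Real.exp_pos (-K * s)).le]
    have h := hanti (Set.mem_Ici.2 le_rfl) (Set.mem_Ici.2 ht) ht
    simp only [F, mul_zero, Real.exp_zero, mul_one, neg_mul, Real.exp_neg, inv_one] at h
    rw [mul_inv_le_iff₀ (Real.exp_pos _)] at h
    exact (Finset.sum_le_sum fun i _ => hφ_ge ε i t).trans h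
  have hlim : Filter.Tendsto (fun ε : ℝ => (∑ i, φ ε i 0) * Real.exp (K * t))
      (nhdsWithin 0 (Set.Ioi 0)) (nhds ((∑ i, ‖Ψ i 0‖) * Real.exp (K * t))) := by
    have hc : Continuous fun ε : ℝ => (∑ i, φ ε i 0) * Real.exp (K * t) := by
      fun_prop
    have h := (hc.tendsto 0).mono_left (nhdsWithin_le_nhds (s := Set.Ioi 0))
    simpa [φ] using h
  exact ge_of_tendsto hlim (Filter.eventually_of_mem self_mem_nhdsWithin hle)

end Energy

section Schwartz

theorem SchwartzMap.lineDerivOp_comm {E F : Type*} [NormedAddCommGroup E] [NormedSpace ℝ E]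
    [NormedAddCommGroup F] [NormedSpace ℝ F] (f : 𝓢(E, F)) (v w : E) :
    ∂_{v} (∂_{w} f) = ∂_{w} (∂_{v} f) := by
  have key (v w : E) (x : E) : ∂_{v} (∂_{w} f) x = fderiv ℝ (fderiv ℝ f) x v w := by
    have hd : DifferentiableAt ℝ (fderiv ℝ f) x :=
      ((f.smooth 2).fderiv_right (m := 1) (by norm_num)).differentiable (by norm_num) x
    have hcoe : ((∂_{w} f : 𝓢(E, F)) : E → F) = fun z => fderiv ℝ f z w :=
      funext fun z => SchwartzMap.lineDerivOp_apply_eq_fderiv w f z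
    rw [SchwartzMap.lineDerivOp_apply_eq_fderiv, hcoe, fderiv_clm_apply hd (by fun_prop)]
    simp
  ext x
  rw [key, key]
  exact ((f.smooth 2).contDiffAt.isSymmSndFDerivAt (by simp)) v w

theorem SchwartzMap.hasDerivAt_fst (f : 𝓢(ℝ × ℝ, ℂ)) (x y : ℝ) :
    HasDerivAt (fun s => f (s, y)) (∂_{((1, 0) : ℝ × ℝ)} f (x, y)) x := by
  rw [SchwartzMap.lineDerivOp_apply_eq_fderiv]
  exact (f.differentiableAt.hasFDerivAt).comp_hasDerivAt x
    ((hasDerivAt_id x).prodMk (hasDerivAt_const x y))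

theorem SchwartzMap.hasDerivAt_snd (f : 𝓢(ℝ × ℝ, ℂ)) (x y : ℝ) :
    HasDerivAt (fun s => f (x, s)) (∂_{((0, 1) : ℝ × ℝ)} f (x, y)) y := by
  rw [SchwartzMap.lineDerivOp_apply_eq_fderiv]
  exact (f.differentiableAt.hasFDerivAt).comp_hasDerivAt y
    ((hasDerivAt_const y x).prodMk (hasDerivAt_id y))

theorem real_inner_I_mul_right (z w : ℂ) :
    inner ℝ z (Complex.I * w) = -inner ℝ w (Complex.I * z) := by
  simp [Complex.inner]
  ring

/-- The operator `i ∂_v ∂_w` is skew-symmetric for the real `L²` inner product. -/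
theorem SchwartzMap.integral_inner_I_mul_lineDerivOp_lineDerivOp (h : 𝓢(ℝ × ℝ, ℂ))
    (v w : ℝ × ℝ) :
    ∫ p, inner ℝ (h p) (Complex.I * ∂_{v} (∂_{w} h) p) = 0 := by
  have hv (v w : ℝ × ℝ) : ∫ p, inner ℝ (h p) (Complex.I * ∂_{v} (∂_{w} h) p) =
      -∫ p, inner ℝ (∂_{v} h p) (Complex.I * ∂_{w} h p) :=
    SchwartzMap.integral_bilinear_lineDerivOp_right_eq_neg_left h (∂_{w} h)
      ((ContinuousLinearMap.compL ℝ ℂ ℂ ℝ).flip (ContinuousLinearMap.mul ℝ ℂ Complex.I) ∘L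
        innerSL ℝ) v
  have h1 := hv v w
  have h2 := hv w v
  rw [← SchwartzMap.lineDerivOp_comm] at h2
  have h3 : ∫ p, inner ℝ (∂_{v} h p) (Complex.I * ∂_{w} h p) =
      -∫ p, inner ℝ (∂_{w} h p) (Complex.I * ∂_{v} h p) := by
    rw [← integral_neg]
    exact integral_congr_ae (ae_of_all _ fun p => real_inner_I_mul_right _ _)
  linarith

theorem Lp.integral_norm_mul_norm_le (f g : Lp ℂ 2 (volume : Measure (ℝ × ℝ))) :
    Integrable (fun p => ‖f p‖ * ‖g p‖) ∧ ∫ p, ‖f p‖ * ‖g p‖ ≤ ‖f‖ * ‖g‖ := by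
  have hf := (Lp.memLp f).norm
  have hg := (Lp.memLp g).norm
  refine ⟨hf.integrable_mul hg, ?_⟩
  have h := real_inner_le_norm (hf.toLp _) (hg.toLp _)
  rw [Lp.norm_toLp, Lp.norm_toLp, eLpNorm_norm, eLpNorm_norm, L2.inner_def] at h
  refine le_trans (le_of_eq (integral_congr_ae ?_)) h
  filter_upwards [hf.coeFn_toLp, hg.coeFn_toLp] with p hp hq
  rw [hp, hq]
  simp [mul_comm]

/-- Energy estimate: the terms `i ∂_x ∂_y` and multiplication by an imaginary function do not
contribute to the growth of the `L²` norm. -/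
theorem inner_le_of_transport_with_source {h : 𝓢(ℝ × ℝ, ℂ)} {w : ℝ × ℝ → ℝ}
    {k s g₁ g₂ : ℝ × ℝ → ℂ} {c₁ c₂ : ℝ} {Ψ Ψ' Γ₁ Γ₂ : Lp ℂ 2 (volume : Measure (ℝ × ℝ))}
    (hΨ : Ψ =ᵐ[volume] h) (hΨ' : Ψ' =ᵐ[volume] k) (hΓ₁ : Γ₁ =ᵐ[volume] g₁)
    (hΓ₂ : Γ₂ =ᵐ[volume] g₂) (hc₁ : 0 ≤ c₁) (hc₂ : 0 ≤ c₂)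
    (hk : ∀ p, k p = Complex.I * ∂_{((1, 0) : ℝ × ℝ)} (∂_{((0, 1) : ℝ × ℝ)} h) p -
      Complex.I * w p * h p + s p)
    (hs : ∀ p, ‖s p‖ ≤ c₁ * ‖g₁ p‖ + c₂ * ‖g₂ p‖) :
    inner ℝ Ψ Ψ' ≤ (c₁ * ‖Γ₁‖ + c₂ * ‖Γ₂‖) * ‖Ψ‖ := by
  obtain ⟨i₁, n₁⟩ := Lp.integral_norm_mul_norm_le Ψ Γ₁
  obtain ⟨i₂, n₂⟩ := Lp.integral_norm_mul_norm_le Ψ Γ₂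
  have hD : Integrable
      (fun p => inner ℝ (h p)
        (Complex.I * ∂_{((1, 0) : ℝ × ℝ)} (∂_{((0, 1) : ℝ × ℝ)} h) p)) := by
    let D := ∂_{((1, 0) : ℝ × ℝ)} (∂_{((0, 1) : ℝ × ℝ)} h)
    refine (L2.integrable_inner (𝕜 := ℝ) (h.toLp 2) ((D.memLp 2).const_mul Complex.I).toLp).congr ?_
    filter_upwards [h.coeFn_toLp 2, ((D.memLp 2).const_mul Complex.I).coeFn_toLp] with p e e'
    rw [e, e']
  have hΓ : Integrable (fun p => c₁ * (‖Ψ p‖ * ‖Γ₁ p‖) + c₂ * (‖Ψ p‖ * ‖Γ₂ p‖)) :=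
    (i₁.const_mul c₁).add (i₂.const_mul c₂)
  have hle : inner ℝ Ψ Ψ' ≤ ∫ p, (inner ℝ (h p)
        (Complex.I * ∂_{((1, 0) : ℝ × ℝ)} (∂_{((0, 1) : ℝ × ℝ)} h) p) +
        (c₁ * (‖Ψ p‖ * ‖Γ₁ p‖) + c₂ * (‖Ψ p‖ * ‖Γ₂ p‖))) := by
    rw [L2.inner_def]
    refine integral_mono_ae (L2.integrable_inner Ψ Ψ')
      (hD.add hΓ) ?_
    filter_upwards [hΨ, hΨ', hΓ₁, hΓ₂] with p e e' e₁ e₂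
    rw [e, e', e₁, e₂, hk, inner_add_right, inner_sub_right]
    have h0 : inner ℝ (h p) (Complex.I * w p * h p) = 0 := by
      simp [Complex.inner]
      ring
    have h1 := (real_inner_le_norm (h p) (s p)).trans
      (mul_le_mul_of_nonneg_left (hs p) (norm_nonneg _))
    rw [h0]
    linarith
  rw [integral_add hD hΓ,
    SchwartzMap.integral_inner_I_mul_lineDerivOp_lineDerivOp,
    integral_add (i₁.const_mul c₁) (i₂.const_mul c₂), integral_const_mul, integral_const_mul] at hle
  nlinarith [mul_le_mul_of_nonneg_left n₁ hc₁, mul_le_mul_of_nonneg_left n₂ hc₂]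

end Schwartz

section Weights

/-- Multiplication of a Schwartz function by the first coordinate. -/
def mulFst (F : 𝓢(ℝ × ℝ, ℂ)) : 𝓢(ℝ × ℝ, ℂ) :=
  SchwartzMap.smulLeftCLM ℂ (fun p : ℝ × ℝ => p.1) F

/-- Multiplication of a Schwartz function by the second coordinate. -/
def mulSnd (F : 𝓢(ℝ × ℝ, ℂ)) : 𝓢(ℝ × ℝ, ℂ) :=
  SchwartzMap.smulLeftCLM ℂ (fun p : ℝ × ℝ => p.2) F

theorem mulFst_apply (F : 𝓢(ℝ × ℝ, ℂ)) (x y : ℝ) : mulFst F (x, y) = x * F (x, y) := by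
  have h := SchwartzMap.smulLeftCLM_apply_apply
    (ContinuousLinearMap.fst ℝ ℝ ℝ).hasTemperateGrowth F (x, y)
  simpa [mulFst] using h

theorem mulSnd_apply (F : 𝓢(ℝ × ℝ, ℂ)) (x y : ℝ) : mulSnd F (x, y) = y * F (x, y) := by
  have h := SchwartzMap.smulLeftCLM_apply_apply
    (ContinuousLinearMap.snd ℝ ℝ ℝ).hasTemperateGrowth F (x, y)
  simpa [mulSnd] using h

theorem lineDerivOp_fst_mulFst (F : 𝓢(ℝ × ℝ, ℂ)) (x y : ℝ) :
    ∂_{((1, 0) : ℝ × ℝ)} (mulFst F) (x, y) =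
      F (x, y) + x * ∂_{((1, 0) : ℝ × ℝ)} F (x, y) := by
  refine ((mulFst F).hasDerivAt_fst x y).unique ?_
  simp only [mulFst_apply]
  simpa using (hasDerivAt_id x).ofReal_comp.fun_mul (F.hasDerivAt_fst x y)

theorem lineDerivOp_snd_mulFst (F : 𝓢(ℝ × ℝ, ℂ)) :
    ∂_{((0, 1) : ℝ × ℝ)} (mulFst F) = mulFst (∂_{((0, 1) : ℝ × ℝ)} F) := by
  ext ⟨x, y⟩
  refine ((mulFst F).hasDerivAt_snd x y).unique ?_
  simp only [mulFst_apply]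
  exact (F.hasDerivAt_snd x y).const_mul _

theorem lineDerivOp_snd_mulSnd (F : 𝓢(ℝ × ℝ, ℂ)) (x y : ℝ) :
    ∂_{((0, 1) : ℝ × ℝ)} (mulSnd F) (x, y) =
      F (x, y) + y * ∂_{((0, 1) : ℝ × ℝ)} F (x, y) := by
  refine ((mulSnd F).hasDerivAt_snd x y).unique ?_
  simp only [mulSnd_apply]
  simpa using (hasDerivAt_id y).ofReal_comp.fun_mul (F.hasDerivAt_snd x y)

theorem lineDerivOp_fst_mulSnd (F : 𝓢(ℝ × ℝ, ℂ)) :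
    ∂_{((1, 0) : ℝ × ℝ)} (mulSnd F) = mulSnd (∂_{((1, 0) : ℝ × ℝ)} F) := by
  ext ⟨x, y⟩
  refine ((mulSnd F).hasDerivAt_fst x y).unique ?_
  simp only [mulSnd_apply]
  exact (F.hasDerivAt_fst x y).const_mul _

end Weights

section Potential

/-- The difference quotient of `V` driving the von Neumann equation in Weyl variables. -/
def weylPotential (hbar : ℝ) (V : ℝ → ℝ) (x y : ℝ) : ℝ :=
  (V (x + hbar * y / 2) - V (x - hbar * y / 2)) / hbar

variable {V : ℝ → ℝ} {hbar L : ℝ}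

theorem hasDerivAt_weylPotential_fst (hV : Differentiable ℝ V) (x y : ℝ) :
    HasDerivAt (fun s => weylPotential hbar V s y)
      ((deriv V (x + hbar * y / 2) - deriv V (x - hbar * y / 2)) / hbar) x := by
  have h1 := (hV (x + hbar * y / 2)).hasDerivAt.comp_add_const x (hbar * y / 2)
  have h2 := (hV (x - hbar * y / 2)).hasDerivAt.comp_sub_const x (hbar * y / 2)
  exact (h1.sub h2).div_const hbar

theorem hasDerivAt_weylPotential_snd (hV : Differentiable ℝ V) (hh : hbar ≠ 0) (x y : ℝ) :
    HasDerivAt (fun s => weylPotential hbar V x s)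
      ((deriv V (x + hbar * y / 2) + deriv V (x - hbar * y / 2)) / 2) y := by
  have h0 : HasDerivAt (fun s : ℝ => hbar * s / 2) (hbar / 2) y := by
    simpa using ((hasDerivAt_id y).const_mul hbar).div_const 2
  have h1 := (hV (x + hbar * y / 2)).hasDerivAt.comp y (h0.const_add x)
  have h2 := (hV (x - hbar * y / 2)).hasDerivAt.comp y (h0.const_sub x)
  refine ((h1.sub h2).div_const hbar).congr_deriv ?_
  field_simp
  ring

theorem abs_deriv_sub_le (hV : ContDiff ℝ 2 V) (hL : ∀ x, |iteratedDeriv 2 V x| ≤ L) (a b : ℝ) :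
    |deriv V a - deriv V b| ≤ L * |a - b| := by
  have hd : Differentiable ℝ (deriv V) := (hV.deriv' (n := 1)).differentiable (by norm_num)
  refine Convex.norm_image_sub_le_of_norm_deriv_le (s := Set.univ) (fun x _ => hd x)
    (fun x _ => ?_) convex_univ (Set.mem_univ b) (Set.mem_univ a)
  simpa [iteratedDeriv_succ] using hL x

theorem abs_weylPotential_deriv_fst_le (hV : ContDiff ℝ 2 V)
    (hL : ∀ x, |iteratedDeriv 2 V x| ≤ L) (hh : 0 < hbar) (x y : ℝ) :
    |(deriv V (x + hbar * y / 2) - deriv V (x - hbar * y / 2)) / hbar| ≤ L * |y| := by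
  rw [abs_div, abs_of_pos hh, div_le_iff₀ hh]
  refine (abs_deriv_sub_le hV hL _ _).trans (le_of_eq ?_)
  rw [show x + hbar * y / 2 - (x - hbar * y / 2) = y * hbar by ring, abs_mul, abs_of_pos hh]
  ring

theorem abs_weylPotential_deriv_snd_le (hV : ContDiff ℝ 2 V)
    (hL : ∀ x, |iteratedDeriv 2 V x| ≤ L) (hV0 : deriv V 0 = 0) (hh : 0 < hbar) (hh2 : hbar ≤ 2)
    (x y : ℝ) :
    |(deriv V (x + hbar * y / 2) + deriv V (x - hbar * y / 2)) / 2| ≤ L * |x| + L * |y| := by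
  have hL0 : 0 ≤ L := (abs_nonneg _).trans (hL 0)
  have h (a : ℝ) : |deriv V a| ≤ L * |a| := by
    simpa [hV0] using abs_deriv_sub_le hV hL a 0
  have hy : |hbar * y / 2| ≤ |y| := by
    rw [abs_div, abs_mul, abs_of_pos hh, abs_two]
    nlinarith [abs_nonneg y]
  have h1 := (h (x + hbar * y / 2)).trans
    (mul_le_mul_of_nonneg_left ((abs_add_le _ _).trans (add_le_add_right hy _)) hL0)
  have h2 := (h (x - hbar * y / 2)).trans
    (mul_le_mul_of_nonneg_left ((abs_sub _ _).trans (add_le_add_right hy _)) hL0)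
  rw [abs_div, abs_two]
  linarith [abs_add_le (deriv V (x + hbar * y / 2)) (deriv V (x - hbar * y / 2))]

end Potential

section WeightedDerivatives

variable (f : ℝ → ℝ → ℂ)

theorem wD_zero : wD 0 0 0 0 f = f := by
  ext; simp [wD, pd2]

theorem wD_fst_weight : wD 1 0 0 0 f = fun x y => x * f x y := by
  ext; simp [wD, pd2]

theorem wD_fst_deriv : wD 0 1 0 0 f = fun x y => deriv (fun s => f s y) x := by
  ext; simp [wD, pd2]

theorem wD_snd_weight : wD 0 0 1 0 f = fun x y => y * f x y := by
  ext; simp [wD, pd2]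

theorem wD_snd_deriv : wD 0 0 0 1 f = fun x y => deriv (fun s => f x s) y := by
  ext; simp [wD, pd2]

theorem NN_one : NN 1 f = L2 (wD 0 0 0 0 f) + L2 (wD 1 0 0 0 f) + L2 (wD 0 1 0 0 f) +
    L2 (wD 0 0 1 0 f) + L2 (wD 0 0 0 1 f) := by
  simp [NN, Finset.sum_filter, Finset.sum_product, Finset.sum_range_succ]
  ring

theorem pd2_one_one {F : 𝓢(ℝ × ℝ, ℂ)} (hF : ∀ x y, F (x, y) = f x y) (x y : ℝ) :
    pd2 1 1 f x y = ∂_{((1, 0) : ℝ × ℝ)} (∂_{((0, 1) : ℝ × ℝ)} F) (x, y) := by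
  simp only [pd2, iteratedDeriv_one, ← hF, (F.hasDerivAt_snd _ _).deriv,
    (SchwartzMap.hasDerivAt_fst _ _ _).deriv]

end WeightedDerivatives

/-- First-order regularity propagation with explicit rate for the von Neumann
equation in Weyl variables. -/
theorem vonNeumann_N1_propagation (V : ℝ → ℝ) (hV : ContDiff ℝ 2 V)
    (hVb : ∃ C : ℝ, ∀ x : ℝ, |iteratedDeriv 2 V x| ≤ C) (hV0 : deriv V 0 = 0)
    (hbar : ℝ) (hh1 : 0 < hbar) (hh2 : hbar ≤ 2)
    (R : ℝ → ℝ → ℝ → ℂ) (hR : IsVNSol hbar V R) :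
    ∀ t : ℝ, 0 ≤ t →
      NN 1 (R t) ≤ NN 1 (R 0) * Real.exp (2 * max 1 (supN (iteratedDeriv 2 V)) * t) := by
  obtain ⟨⟨-, hS, hC⟩, heq⟩ := hR
  choose ψ ψ' hψ hψ' hder _ using hC
  set L := max 1 (supN (iteratedDeriv 2 V)) with hL_def
  have hL1 : 1 ≤ L := le_max_left _ _
  have hL0 : 0 ≤ L := zero_le_one.trans hL1
  have hL (x : ℝ) : |iteratedDeriv 2 V x| ≤ L := by
    obtain ⟨C, hC⟩ := hVb
    exact (le_ciSup (f := fun x => |iteratedDeriv 2 V x|) ⟨C, by rintro _ ⟨x, rfl⟩; exact hC x⟩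
      x).trans (le_max_right _ _)
  have hVd : Differentiable ℝ V := hV.differentiable (by norm_num)
  have hnorm (a b α β : ℕ) (t : ℝ) (ht : 0 ≤ t) :
      L2 (wD a b α β (R t)) = ‖ψ a b α β t‖ := by
    rw [Lp.norm_def, eLpNorm_congr_ae (hψ a b α β t ht), L2]
  have hest (t : ℝ) (ht : 0 ≤ t) :
      inner ℝ (ψ 0 0 0 0 t) (ψ' 0 0 0 0 t) ≤ 0 * ‖ψ 0 0 0 0 t‖ ∧
      inner ℝ (ψ 1 0 0 0 t) (ψ' 1 0 0 0 t) ≤ ‖ψ 0 0 0 1 t‖ * ‖ψ 1 0 0 0 t‖ ∧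
      inner ℝ (ψ 0 1 0 0 t) (ψ' 0 1 0 0 t) ≤ L * ‖ψ 0 0 1 0 t‖ * ‖ψ 0 1 0 0 t‖ ∧
      inner ℝ (ψ 0 0 1 0 t) (ψ' 0 0 1 0 t) ≤ ‖ψ 0 1 0 0 t‖ * ‖ψ 0 0 1 0 t‖ ∧
      inner ℝ (ψ 0 0 0 1 t) (ψ' 0 0 0 1 t) ≤
        (L * ‖ψ 1 0 0 0 t‖ + L * ‖ψ 0 0 1 0 t‖) * ‖ψ 0 0 0 1 t‖ := by
    let F : 𝓢(ℝ × ℝ, ℂ) := ⟨unc (R t), (hS t ht).1, (hS t ht).2⟩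
    have hF (x y : ℝ) : R t x y = F (x, y) := rfl
    let Fx := ∂_{((1, 0) : ℝ × ℝ)} F
    let Fy := ∂_{((0, 1) : ℝ × ℝ)} F
    let Fxy := ∂_{((1, 0) : ℝ × ℝ)} Fy
    let W := weylPotential hbar V
    have hk : dtR R t = fun x y => Complex.I * Fxy (x, y) - Complex.I * W x y * F (x, y) := by
      ext x y
      rw [heq t ht, pd2_one_one (R t) (F := F) fun _ _ => rfl]
      rfl
    have hcomm : ∂_{((0, 1) : ℝ × ℝ)} Fx = Fxy := SchwartzMap.lineDerivOp_comm _ _ _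
    have e0 : ψ 0 0 0 0 t =ᵐ[volume] F := by
      refine (hψ 0 0 0 0 t ht).trans (Filter.EventuallyEq.of_eq ?_)
      rw [wD_zero]
      rfl
    have e1 : ψ 1 0 0 0 t =ᵐ[volume] mulFst F := by
      refine (hψ 1 0 0 0 t ht).trans (Filter.EventuallyEq.of_eq ?_)
      ext ⟨x, y⟩
      simp [unc, wD_fst_weight, mulFst_apply, hF]
    have e2 : ψ 0 1 0 0 t =ᵐ[volume] Fx := by
      refine (hψ 0 1 0 0 t ht).trans (Filter.EventuallyEq.of_eq ?_)
      ext ⟨x, y⟩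
      simp only [unc, wD_fst_deriv]
      exact (F.hasDerivAt_fst x y).deriv
    have e3 : ψ 0 0 1 0 t =ᵐ[volume] mulSnd F := by
      refine (hψ 0 0 1 0 t ht).trans (Filter.EventuallyEq.of_eq ?_)
      ext ⟨x, y⟩
      simp [unc, wD_snd_weight, mulSnd_apply, hF]
    have e4 : ψ 0 0 0 1 t =ᵐ[volume] Fy := by
      refine (hψ 0 0 0 1 t ht).trans (Filter.EventuallyEq.of_eq ?_)
      ext ⟨x, y⟩
      simp only [unc, wD_snd_deriv]
      exact (F.hasDerivAt_snd x y).deriv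
    refine ⟨?_, ?_, ?_, ?_, ?_⟩
    · refine (inner_le_of_transport_with_source (w := fun p => W p.1 p.2) (s := 0) e0 (hψ' 0 0 0 0 t ht) e0 e0
        le_rfl le_rfl ?_ ?_).trans_eq (by ring)
      · rintro ⟨x, y⟩
        simp [unc, wD_zero, hk, Fxy, Fy]
      · simp
    · refine (inner_le_of_transport_with_source (w := fun p => W p.1 p.2)
        (s := fun p => -(Complex.I * Fy p)) e1 (hψ' 1 0 0 0 t ht) e4 e0
        zero_le_one le_rfl ?_ ?_).trans_eq (by ring)
      · rintro ⟨x, y⟩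
        simp only [unc, wD_fst_weight, hk, lineDerivOp_snd_mulFst, lineDerivOp_fst_mulFst,
          mulFst_apply, Fxy, Fy]
        ring
      · simp
    · refine (inner_le_of_transport_with_source (w := fun p => W p.1 p.2)
        (s := fun p => -(Complex.I * ((deriv V (p.1 + hbar * p.2 / 2) -
          deriv V (p.1 - hbar * p.2 / 2)) / hbar : ℝ) * F p)) e2 (hψ' 0 1 0 0 t ht) e3 e0
        hL0 le_rfl ?_ ?_).trans_eq (by ring)
      · rintro ⟨x, y⟩
        have hd := ((Fxy.hasDerivAt_fst x y).const_mul Complex.I).sub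
          (((hasDerivAt_weylPotential_fst (hbar := hbar) hVd x y).ofReal_comp.const_mul
            Complex.I).fun_mul (F.hasDerivAt_fst x y))
        simp only [unc, wD_fst_deriv, hk]
        refine hd.deriv.trans ?_
        rw [hcomm]
        simp only [Fx, W]
        ring
      · rintro ⟨x, y⟩
        have h := mul_le_mul_of_nonneg_right
          (abs_weylPotential_deriv_fst_le hV hL hh1 x y) (norm_nonneg (F (x, y)))
        simp only [norm_neg, norm_mul, Complex.norm_I, Complex.norm_real, Real.norm_eq_abs,
          mulSnd_apply]
        linarith
    · refine (inner_le_of_transport_with_source (w := fun p => W p.1 p.2)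
        (s := fun p => -(Complex.I * Fx p)) e3 (hψ' 0 0 1 0 t ht) e2 e0
        zero_le_one le_rfl ?_ ?_).trans_eq (by ring)
      · rintro ⟨x, y⟩
        rw [SchwartzMap.lineDerivOp_comm, lineDerivOp_fst_mulSnd, lineDerivOp_snd_mulSnd, hcomm]
        simp only [unc, wD_snd_weight, hk, mulSnd_apply, Fx]
        ring
      · simp
    · refine (inner_le_of_transport_with_source (w := fun p => W p.1 p.2)
        (s := fun p => -(Complex.I * ((deriv V (p.1 + hbar * p.2 / 2) +
          deriv V (p.1 - hbar * p.2 / 2)) / 2 : ℝ) * F p)) e4 (hψ' 0 0 0 1 t ht) e1 e3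
        hL0 hL0 ?_ ?_)
      · rintro ⟨x, y⟩
        have hd := ((Fxy.hasDerivAt_snd x y).const_mul Complex.I).sub
          (((hasDerivAt_weylPotential_snd hVd hh1.ne' x y).ofReal_comp.const_mul
            Complex.I).fun_mul (F.hasDerivAt_snd x y))
        simp only [unc, wD_snd_deriv, hk]
        refine hd.deriv.trans ?_
        rw [SchwartzMap.lineDerivOp_comm Fy]
        simp only [Fy, W]
        ring
      · rintro ⟨x, y⟩
        have h := mul_le_mul_of_nonneg_right
          (abs_weylPotential_deriv_snd_le hV hL hV0 hh1 hh2 x y) (norm_nonneg (F (x, y)))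
        simp only [norm_neg, norm_mul, Complex.norm_I, Complex.norm_real, Real.norm_eq_abs,
          mulFst_apply, mulSnd_apply]
        linarith
  intro t ht
  have key := sum_norm_le_mul_exp_of_inner_le (K := 2 * L)
    (Ψ := ![ψ 0 0 0 0, ψ 1 0 0 0, ψ 0 1 0 0, ψ 0 0 1 0, ψ 0 0 0 1])
    (Ψ' := ![ψ' 0 0 0 0, ψ' 1 0 0 0, ψ' 0 1 0 0, ψ' 0 0 1 0, ψ' 0 0 0 1])
    (G := ![fun _ => 0, fun s => ‖ψ 0 0 0 1 s‖, fun s => L * ‖ψ 0 0 1 0 s‖,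
      fun s => ‖ψ 0 1 0 0 s‖, fun s => L * ‖ψ 1 0 0 0 s‖ + L * ‖ψ 0 0 1 0 s‖])
    (by positivity)
    (fun i s hs => by fin_cases i <;> exact hder _ _ _ _ s hs)
    (fun i s hs => by fin_cases i <;> simp <;> positivity)
    (fun i s hs => by
      obtain ⟨h0, h1, h2, h3, h4⟩ := hest s hs
      fin_cases i <;> assumption)
    (fun s hs => by
      simp only [Fin.sum_univ_five, Matrix.cons_val]
      nlinarith [norm_nonneg (ψ 0 0 0 0 s), norm_nonneg (ψ 1 0 0 0 s),
        norm_nonneg (ψ 0 1 0 0 s), norm_nonneg (ψ 0 0 1 0 s), norm_nonneg (ψ 0 0 0 1 s)]) ht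
  simp only [Fin.sum_univ_five, Matrix.cons_val] at key
  simpa only [NN_one, hnorm _ _ _ _ t ht, hnorm _ _ _ _ 0 le_rfl] using key

end
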